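/- arXiv:2511.02641 — 7 statements merged into one kernel-verified Lean document; each statement's English description precedes it below -/
import Mathlib

section
/- The set J := {g ∈ G(B,γ) : 0 ≤ π_1(g) < m}, where π_1 : ℤ ⊕ L/B → ℤ is the first projection, belongs to 𝒥; that is, J contains exactly one element of each coset of ℤp in G(B,γ), and for every g ∈ J and 0 ≤ i ≤ d one has g + x_i ∈ J ∪ (J + p). In particular, 𝒥 is non-empty. -/
open scoped Classical

noncomputable section

namespace Paper

/-- The ambient lattice `ℤ^(d+1)`. -/
abbrev V (d : ℕ) : Type := Fin (d + 1) → ℤ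

/-- The coordinate-sum homomorphism. -/
def sumHom (d : ℕ) : V d →+ ℤ :=
  AddMonoidHom.mk' (fun v => ∑ i, v i) (fun a b => by
    simp [Finset.sum_add_distrib])

/-- The lattice `L` of integer vectors with coordinate sum zero. -/
def L (d : ℕ) : AddSubgroup (V d) := (sumHom d).ker

/-- `α i = e_i - e_{i-1}` (indices cyclic mod `d+1`), as an element of `L`. -/
def alpha (d : ℕ) (i : Fin (d + 1)) : L d :=
  ⟨Pi.single i 1 - Pi.single (i - 1) 1, by
    have : sumHom d (Pi.single i 1 - Pi.single (i - 1) 1) = 0 := by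
      simp [sumHom, Finset.sum_sub_distrib, Pi.single_apply]
    exact this⟩

/-- Arrows of the infinite quiver `Q̂`: the pair (source, type); the arrow of type `i`
with source `x` goes from `x` to `x + α i`. -/
abbrev ArrowHat (d : ℕ) : Type := L d × Fin (d + 1)

/-- Arrows of the quiver `Q` on `L/B`: the pair (source, type). -/
abbrev Arrow (d : ℕ) (B : AddSubgroup (L d)) : Type := (L d ⧸ B) × Fin (d + 1)

/-- The preimage among arrows of `Q̂` of a set of arrows of `Q`. -/
def preim (d : ℕ) (B : AddSubgroup (L d)) (C : Set (Arrow d B)) : Set (ArrowHat d) :=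
  {a | ((QuotientAddGroup.mk a.1 : L d ⧸ B), a.2) ∈ C}

/-- A set of arrows of `Q̂` is a cut if it contains exactly one arrow of every elementary
cycle.  Elementary cycles are exactly the cyclic paths of length `d+1` with pairwise distinct
types; they are parametrized by a starting vertex `x` and a permutation `σ` of the types,
the `k`-th arrow being the type-`σ k` arrow with source `x + ∑_{j<k} α (σ j)`. -/
def IsCutHat (d : ℕ) (Ch : Set (ArrowHat d)) : Prop :=
  ∀ (x : L d) (σ : Equiv.Perm (Fin (d + 1))),
    ∃! k : Fin (d + 1), (x + ∑ j ∈ Finset.Iio k, alpha d (σ j), σ k) ∈ Ch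

/-- A set of arrows of `Q̂` is `B`-periodic if it is invariant under translation by `B`. -/
def IsBPeriodic (d : ℕ) (B : AddSubgroup (L d)) (Ch : Set (ArrowHat d)) : Prop :=
  ∀ (a : ArrowHat d) (b : L d), b ∈ B → ((a.1 + b, a.2) ∈ Ch ↔ a ∈ Ch)

/-- A set of arrows of `Q` is a cut if its preimage among the arrows of `Q̂` is a cut. -/
def IsCut (d : ℕ) (B : AddSubgroup (L d)) (C : Set (Arrow d B)) : Prop :=
  IsCutHat d (preim d B C)

/-- The type of a cut of `Q`: the `i`-th entry is the number of arrows of type `i` in it. -/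
def cutType (d : ℕ) (B : AddSubgroup (L d)) (C : Set (Arrow d B)) : Fin (d + 1) → ℤ :=
  fun i => (Nat.card {v : L d ⧸ B // (v, i) ∈ C} : ℤ)

/-- A cut detector of type `γ`. -/
def IsCutDetector (d : ℕ) (B : AddSubgroup (L d)) (f : L d ⧸ B → ℤ)
    (γ : Fin (d + 1) → ℤ) : Prop :=
  f 0 = 0 ∧ ∀ (x : L d) (i : Fin (d + 1)),
    f (QuotientAddGroup.mk (x + alpha d i)) = f (QuotientAddGroup.mk x) + γ i ∨
    f (QuotientAddGroup.mk (x + alpha d i)) = f (QuotientAddGroup.mk x) + γ i - (B.index : ℤ)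

/-- The value `f_C` of an arrow of `Q̂`: `γ i - m` if the arrow lies in the given set of
arrows, and `γ i` otherwise (for an arrow of type `i`). -/
def arrowVal (d : ℕ) (Ch : Set (ArrowHat d)) (γ : Fin (d + 1) → ℤ) (m : ℤ)
    (a : ArrowHat d) : ℤ :=
  if a ∈ Ch then γ a.2 - m else γ a.2

/-- The value `f_C` of a path in `Q̂`, the path being recorded as its list of types together
with its source: the sum of the values of its arrows. -/
def pathVal (d : ℕ) (Ch : Set (ArrowHat d)) (γ : Fin (d + 1) → ℤ) (m : ℤ) :
    List (Fin (d + 1)) → L d → ℤ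
  | [], _ => 0
  | i :: p, x => arrowVal d Ch γ m (x, i) + pathVal d Ch γ m p (x + alpha d i)

/-- `f` is the function `f̄_C` induced by `f_C` on `L/B`:  for every `x ∈ L` and every path
`p` in `Q̂` from `0` to `x`, `f(x + B)` is the value of `p`. -/
def Detects (d : ℕ) (B : AddSubgroup (L d)) (C : Set (Arrow d B)) (γ : Fin (d + 1) → ℤ)
    (f : L d ⧸ B → ℤ) : Prop :=
  ∀ (x : L d) (p : List (Fin (d + 1))), (p.map (alpha d)).sum = x →
    f (QuotientAddGroup.mk x) = pathVal d (preim d B C) γ (B.index : ℤ) p 0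

/-- The set of arrows `C_f` of `Q` associated to a function `f : L/B → ℤ` (of type `γ`):
the arrows `x + B → x + α i + B` with `f(x + α i + B) = f(x + B) + γ i - m`. -/
def cutOf (d : ℕ) (B : AddSubgroup (L d)) (f : L d ⧸ B → ℤ) (γ : Fin (d + 1) → ℤ) :
    Set (Arrow d B) :=
  {a | ∃ x : L d, QuotientAddGroup.mk x = a.1 ∧
      f (QuotientAddGroup.mk (x + alpha d a.2)) = f a.1 + γ a.2 - (B.index : ℤ)}


/-- A path in the quiver `Q_C = Q ∖ C`, recorded as its list of types plus its source:
all its arrows avoid `C`. -/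
def avoids (d : ℕ) (B : AddSubgroup (L d)) (C : Set (Arrow d B)) :
    List (Fin (d + 1)) → (L d ⧸ B) → Prop
  | [], _ => True
  | i :: p, v => (v, i) ∉ C ∧ avoids d B C p (v + QuotientAddGroup.mk (alpha d i))

/-- A cut `C` of `Q` is bounding if the quiver `Q_C` obtained by deleting the arrows of `C`
has no cyclic path of positive length. -/
def IsBounding (d : ℕ) (B : AddSubgroup (L d)) (C : Set (Arrow d B)) : Prop :=
  ¬ ∃ (v : L d ⧸ B) (p : List (Fin (d + 1))), p ≠ [] ∧ avoids d B C p v ∧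
      v + QuotientAddGroup.mk ((p.map (alpha d)).sum) = v

/-- The homomorphism `Φ : ℤ^(d+1) → ℤ ⊕ L/B` with `Φ(e_i) = (γ_i, α_i + B)`. -/
def Phi (d : ℕ) (B : AddSubgroup (L d)) (γ : Fin (d + 1) → ℤ) :
    V d →+ ℤ × (L d ⧸ B) :=
  AddMonoidHom.mk'
    (fun v => (∑ i, v i * γ i, QuotientAddGroup.mk (∑ i, v i • alpha d i)))
    (fun a b => by
      have h1 : ∑ i, (a + b) i * γ i = (∑ i, a i * γ i) + ∑ i, b i * γ i := by
        rw [← Finset.sum_add_distrib]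
        exact Finset.sum_congr rfl fun i _ => by simp [add_mul]
      have h2 : (∑ i, (a + b) i • alpha d i) =
          (∑ i, a i • alpha d i) + ∑ i, b i • alpha d i := by
        rw [← Finset.sum_add_distrib]
        exact Finset.sum_congr rfl fun i _ => by simp [add_smul]
      show (∑ i, (a + b) i * γ i, QuotientAddGroup.mk (∑ i, (a + b) i • alpha d i)) =
        ((∑ i, a i * γ i, QuotientAddGroup.mk (∑ i, a i • alpha d i)) : ℤ × (L d ⧸ B)) +
          (∑ i, b i * γ i, QuotientAddGroup.mk (∑ i, b i • alpha d i))
      rw [Prod.mk_add_mk, h1, h2, QuotientAddGroup.mk_add])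

/-- The group `G(B,γ)`, the image of `Φ`. -/
abbrev GB (d : ℕ) (B : AddSubgroup (L d)) (γ : Fin (d + 1) → ℤ) :
    AddSubgroup (ℤ × (L d ⧸ B)) :=
  (Phi d B γ).range

/-- The element `x_i = Φ(e_i)` of `G(B,γ)`. -/
def xE (d : ℕ) (B : AddSubgroup (L d)) (γ : Fin (d + 1) → ℤ) (i : Fin (d + 1)) :
    GB d B γ :=
  ⟨Phi d B γ (Pi.single i 1), ⟨Pi.single i 1, rfl⟩⟩

/-- The element `p = ∑ x_i` of `G(B,γ)`. -/
def pE (d : ℕ) (B : AddSubgroup (L d)) (γ : Fin (d + 1) → ℤ) : GB d B γ :=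
  ∑ i, xE d B γ i

/-- Membership in `𝒥`: `J` contains exactly one element of every coset of `ℤp`, and for
`g ∈ J` and every `i`, `g + x_i ∈ J ∪ (J + p)`. -/
def InJ (d : ℕ) (B : AddSubgroup (L d)) (γ : Fin (d + 1) → ℤ)
    (J : Set (GB d B γ)) : Prop :=
  (∀ g : GB d B γ, ∃! n : ℤ, g + n • pE d B γ ∈ J) ∧
    ∀ g ∈ J, ∀ i : Fin (d + 1), g + xE d B γ i ∈ J ∨ g + xE d B γ i - pE d B γ ∈ J

/-- `f` is the function `f_J : L/B → ℤ` attached to `J ∈ 𝒥`:  whenever `n_J • p ∈ J`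
and `g ∈ J`, the value of `f` at the image of `g` under the second projection is
`π₁(g) - n_J · m`. -/
def IsFJ (d : ℕ) (B : AddSubgroup (L d)) (γ : Fin (d + 1) → ℤ)
    (J : Set (GB d B γ)) (f : L d ⧸ B → ℤ) : Prop :=
  ∀ n : ℤ, n • pE d B γ ∈ J → ∀ g ∈ J,
    f (g : ℤ × (L d ⧸ B)).2 = (g : ℤ × (L d ⧸ B)).1 - n * (B.index : ℤ)

/-- The cone of nonnegative integer combinations of the `x i`. -/
def cone {G : Type*} [AddCommGroup G] {n : ℕ} (x : Fin n → G) : Set G :=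
  {g | ∃ c : Fin n → ℕ, g = ∑ i, (c i : ℤ) • x i}

/-- Upper sets for the partial order `g ≤ h ↔ h - g ∈ cone x`. -/
def IsUpper {G : Type*} [AddCommGroup G] {n : ℕ} (x : Fin n → G) (I : Set G) : Prop :=
  ∀ g ∈ I, ∀ h : G, h - g ∈ cone x → h ∈ I

/-- `J(I) = I ∩ (Iᶜ + p)`. -/
def JofI {G : Type*} [AddCommGroup G] (p : G) (I : Set G) : Set G :=
  {g | g ∈ I ∧ g - p ∉ I}

/-- The set `𝒥̃` of subsets `J` with `g ≱ h + p` for all `g, h ∈ J` (where `p = ∑ x i`). -/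
def tilJSet {G : Type*} [AddCommGroup G] {n : ℕ} (x : Fin n → G) : Set (Set G) :=
  {J | ∀ g ∈ J, ∀ h ∈ J, g - (h + ∑ i, x i) ∉ cone x}

/-- The homomorphism `ℤ^(d+1) → G` sending `e_i` to `x i`. -/
def PhiG {G : Type*} [AddCommGroup G] (d : ℕ) (x : Fin (d + 1) → G) : V d →+ G :=
  AddMonoidHom.mk' (fun v => ∑ i, v i • x i) (fun a b => by
    rw [← Finset.sum_add_distrib]
    exact Finset.sum_congr rfl fun i _ => by simp [add_smul])

/-- A finitely generated abelian group of rank one with elements `x_0, …, x_d`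
satisfying (G1), (G2), (G3).  (Rank one is expressed by the existence of a surjective
homomorphism to `ℤ` whose kernel is exactly the torsion.) -/
def GoodPair (d : ℕ) (G : Type*) [AddCommGroup G] (x : Fin (d + 1) → G) : Prop :=
  AddGroup.FG G ∧
  (∃ π' : G →+ ℤ, Function.Surjective π' ∧ ∀ g : G, π' g = 0 ↔ IsOfFinAddOrder g) ∧
  (∀ i, x i ≠ 0) ∧
  (∀ g : G, ∃ c : Fin (d + 1) → ℤ, g = ∑ i, c i • x i) ∧
  (∀ g : G, g ∈ cone x → -g ∈ cone x → g = 0)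

/-- A pair `(B, γ)` of a finite-index subgroup `B ⊆ L` and a positive integer vector `γ`
satisfying the two conditions of Theorem `chartype`. -/
def GoodBgamma (d : ℕ) (B : AddSubgroup (L d)) (γ : Fin (d + 1) → ℤ) : Prop :=
  B.FiniteIndex ∧ (∀ i, 0 < γ i) ∧ (∑ i, γ i) = (B.index : ℤ) ∧
    ∀ m' : Fin (d + 1) → ℤ, (∑ i, m' i • alpha d i) ∈ B →
      (B.index : ℤ) ∣ ∑ i, m' i * γ i

theorem xE_fst (d : ℕ) (B : AddSubgroup (L d)) (γ : Fin (d + 1) → ℤ) (i : Fin (d + 1)) :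
    (xE d B γ i : ℤ × (L d ⧸ B)).1 = γ i := by
  show ∑ j, (Pi.single i 1 : V d) j * γ j = γ i
  simp [Pi.single_apply]

theorem pE_fst (d : ℕ) (B : AddSubgroup (L d)) (γ : Fin (d + 1) → ℤ) :
    (pE d B γ : ℤ × (L d ⧸ B)).1 = ∑ i, γ i := by
  rw [pE, AddSubgroup.val_finset_sum, Prod.fst_sum]
  exact Finset.sum_congr rfl fun i _ => xE_fst d B γ i

theorem interval_mem_J (d : ℕ) (hd : 1 ≤ d) (B : AddSubgroup (L d)) [B.FiniteIndex]
    (γ : Fin (d + 1) → ℤ) (hγ : ∀ i, 0 ≤ γ i)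
    (hsum : (∑ i, γ i) = (B.index : ℤ))
    (hadm : ∀ m' : Fin (d + 1) → ℤ, (∑ i, m' i • alpha d i) ∈ B →
      (B.index : ℤ) ∣ ∑ i, m' i * γ i) :
    InJ d B γ {g : GB d B γ |
      0 ≤ (g : ℤ × (L d ⧸ B)).1 ∧ (g : ℤ × (L d ⧸ B)).1 < (B.index : ℤ)} := by
  have hm : (0 : ℤ) < (B.index : ℤ) := by
    exact_mod_cast Nat.pos_of_ne_zero AddSubgroup.FiniteIndex.index_ne_zero
  have hp := pE_fst d B γ
  rw [hsum] at hp
  refine ⟨fun g => ?_, fun g hg i => ?_⟩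
  · have h := existsUnique_add_zsmul_mem_Ico hm (g : ℤ × (L d ⧸ B)).1 0
    simpa [Set.mem_Ico, hp] using h
  · have hx := xE_fst d B γ i
    have hle : γ i ≤ (B.index : ℤ) := by
      rw [← hsum]
      exact Finset.single_le_sum (fun j _ => hγ j) (Finset.mem_univ i)
    have h0 := hγ i
    simp only [Set.mem_setOf_eq, AddSubgroup.coe_add, AddSubgroup.coe_sub, Prod.fst_add,
      Prod.fst_sub, hx, hp] at hg ⊢
    omega

end Paper
end
end

section
/- Assume moreover that γ_i > 0 for all 0 ≤ i ≤ d. Then G(B,γ) is a finitely generated abelian group of rank one, and the elements x_0,…,x_d ∈ G(B,γ) satisfy: (G1) x_i ≠ 0 for all i; (G2) G(B,γ) = Σ_{i=0}^d ℤx_i; (G3) G_{≥0} ∩ (−G_{≥0}) = {0}, where G_{≥0} := Σ_{i=0}^d ℤ_{≥0}x_i. -/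
open scoped Classical

noncomputable section

namespace Paper

lemma sum_c_xE (d : ℕ) (B : AddSubgroup (L d)) (γ : Fin (d + 1) → ℤ) (c : Fin (d + 1) → ℤ) :
    ((∑ i, c i • xE d B γ i : GB d B γ) : ℤ × (L d ⧸ B)) = Phi d B γ c := by
  have hc : c = ∑ i, c i • (Pi.single i 1 : V d) := by
    ext j
    simp [Finset.sum_apply, Pi.single_apply]
  conv_rhs => rw [hc, map_sum]
  rw [AddSubgroup.val_finset_sum]
  refine Finset.sum_congr rfl fun i _ => ?_
  rw [map_zsmul]
  rfl

lemma fst_sum (d : ℕ) (B : AddSubgroup (L d)) (γ : Fin (d + 1) → ℤ) (c : Fin (d + 1) → ℤ) :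
    ((∑ i, c i • xE d B γ i : GB d B γ) : ℤ × (L d ⧸ B)).1 = ∑ i, c i * γ i := by
  rw [sum_c_xE]
  rfl

theorem GB_rank_one_and_G1G2G3 (d : ℕ) (hd : 1 ≤ d) (B : AddSubgroup (L d))
    [B.FiniteIndex] (γ : Fin (d + 1) → ℤ) (hγ : ∀ i, 0 < γ i)
    (hsum : (∑ i, γ i) = (B.index : ℤ))
    (hadm : ∀ m' : Fin (d + 1) → ℤ, (∑ i, m' i • alpha d i) ∈ B →
      (B.index : ℤ) ∣ ∑ i, m' i * γ i) :
    AddGroup.FG (GB d B γ) ∧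
    (∃ π' : GB d B γ →+ ℤ, Function.Surjective π' ∧
      ∀ g : GB d B γ, π' g = 0 ↔ IsOfFinAddOrder g) ∧
    (∀ i, xE d B γ i ≠ 0) ∧
    (∀ g : GB d B γ, ∃ c : Fin (d + 1) → ℤ, g = ∑ i, c i • xE d B γ i) ∧
    (∀ g : GB d B γ, g ∈ cone (xE d B γ) → -g ∈ cone (xE d B γ) → g = 0) := by
  have hG2 : ∀ g : GB d B γ, ∃ c : Fin (d + 1) → ℤ, g = ∑ i, c i • xE d B γ i := by
    rintro ⟨g, c, rfl⟩
    exact ⟨c, Subtype.ext (sum_c_xE d B γ c).symm⟩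
  have hx1 : ∀ i, ((xE d B γ i : GB d B γ) : ℤ × (L d ⧸ B)).1 = γ i := by
    intro i
    have : ((xE d B γ i : GB d B γ) : ℤ × (L d ⧸ B)).1
        = ∑ j, (Pi.single i 1 : V d) j * γ j := rfl
    rw [this]
    simp [Pi.single_apply]
  refine ⟨?_, ?_, ?_, hG2, ?_⟩
  · have : AddGroup.FG (V d) := inferInstance
    exact AddGroup.fg_of_surjective (Phi d B γ).rangeRestrict_surjective
  · let π : GB d B γ →+ ℤ := (AddMonoidHom.fst ℤ (L d ⧸ B)).comp (GB d B γ).subtype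
    have hπ : ∀ g : GB d B γ, π g = (g : ℤ × (L d ⧸ B)).1 := fun g => rfl
    obtain ⟨k, hk⟩ := Int.subgroup_cyclic π.range
    rw [← AddSubgroup.zmultiples_eq_closure] at hk
    have hdvd : ∀ g, k ∣ π g := by
      intro g
      have : π g ∈ π.range := ⟨g, rfl⟩
      rw [hk] at this
      exact Int.mem_zmultiples_iff.1 this
    have hk0 : k ≠ 0 := by
      rintro rfl
      have h := hdvd (xE d B γ 0)
      rw [hπ, hx1, zero_dvd_iff] at h
      exact (hγ 0).ne' h
    refine ⟨AddMonoidHom.mk' (fun g => π g / k) (fun a b => ?_), ?_, ?_⟩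
    · show π (a + b) / k = π a / k + π b / k
      rw [map_add, Int.add_ediv_of_dvd_left (hdvd a)]
    · intro n
      have : n * k ∈ π.range := by
        rw [hk]
        exact Int.mem_zmultiples_iff.2 (Dvd.intro_left n rfl)
      obtain ⟨g, hg⟩ := this
      refine ⟨g, ?_⟩
      show π g / k = n
      rw [hg, Int.mul_ediv_cancel _ hk0]
    · intro g
      show π g / k = 0 ↔ _
      have h0 : π g / k = 0 ↔ π g = 0 := by
        constructor
        · intro h
          have := Int.ediv_mul_cancel (hdvd g)
          rw [h, zero_mul] at this
          exact this.symm
        · intro h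
          simp [h]
      rw [h0]
      constructor
      · intro h
        rw [isOfFinAddOrder_iff_nsmul_eq_zero]
        refine ⟨B.index, Nat.pos_of_ne_zero AddSubgroup.FiniteIndex.index_ne_zero, ?_⟩
        apply Subtype.ext
        apply Prod.ext
        · show B.index • π g = 0
          simp [h]
        · show B.index • (g : ℤ × (L d ⧸ B)).2 = 0
          rw [AddSubgroup.index]
          exact card_nsmul_eq_zero'
      · intro h
        rw [isOfFinAddOrder_iff_nsmul_eq_zero] at h
        obtain ⟨n, hn, h⟩ := h
        have h2 : n • π g = 0 := by rw [← map_nsmul, h, map_zero]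
        exact (smul_eq_zero.1 h2).resolve_left hn.ne'
  · intro i h
    have h1 := hx1 i
    rw [h] at h1
    exact (hγ i).ne h1
  · rintro g ⟨a, ha⟩ ⟨b, hb⟩
    have h1 : (g : ℤ × (L d ⧸ B)).1 = ∑ i, (a i : ℤ) * γ i := by
      rw [ha]
      exact fst_sum d B γ fun i => (a i : ℤ)
    have h2 : -(g : ℤ × (L d ⧸ B)).1 = ∑ i, (b i : ℤ) * γ i := by
      have : ((-g : GB d B γ) : ℤ × (L d ⧸ B)).1 = ∑ i, (b i : ℤ) * γ i := by
        rw [hb]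
        exact fst_sum d B γ fun i => (b i : ℤ)
      exact this
    have ha0 : ∀ i ∈ Finset.univ, 0 ≤ (a i : ℤ) * γ i := fun i _ =>
      mul_nonneg (Int.natCast_nonneg _) (hγ i).le
    have hb0 : 0 ≤ ∑ i, (b i : ℤ) * γ i := Finset.sum_nonneg fun i _ =>
      mul_nonneg (Int.natCast_nonneg _) (hγ i).le
    have hs : ∑ i, (a i : ℤ) * γ i = 0 := by
      have := Finset.sum_nonneg ha0
      omega
    rw [Finset.sum_eq_zero_iff_of_nonneg ha0] at hs
    rw [ha]
    refine Finset.sum_eq_zero fun i hi => ?_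
    rw [(mul_eq_zero.1 (hs i hi)).resolve_right (hγ i).ne', zero_smul]

end Paper
end
end

section
/- Let G be a finitely generated abelian group of rank one and let x_0,…,x_d ∈ G satisfy (G1)–(G3). For a subset J ⊆ G, the following are equivalent: (1) J ∈ 𝒥_G; (2) J contains exactly one element of each coset of ℤp in G, and for every g ∈ J and 0 ≤ i ≤ d one has g + x_i ∈ J ∪ (J + p). -/
open scoped Classical

noncomputable section

namespace Paper

section Helpers

variable {G : Type*} [AddCommGroup G] {n : ℕ} {x : Fin n → G}

lemma cone_zero : (0 : G) ∈ cone x := ⟨fun _ => 0, by simp⟩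

lemma cone_add {a b : G} (ha : a ∈ cone x) (hb : b ∈ cone x) : a + b ∈ cone x := by
  obtain ⟨c, rfl⟩ := ha
  obtain ⟨e, rfl⟩ := hb
  refine ⟨fun i => c i + e i, ?_⟩
  rw [← Finset.sum_add_distrib]
  exact Finset.sum_congr rfl fun i _ => by push_cast; rw [add_smul]

lemma cone_gen (i : Fin n) : x i ∈ cone x := by
  refine ⟨fun j => if j = i then 1 else 0, ?_⟩
  simp [ite_smul]

/-- The cone as an additive submonoid. -/
def coneM (x : Fin n → G) : AddSubmonoid G where
  carrier := cone x
  zero_mem' := cone_zero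
  add_mem' := cone_add

lemma cone_sum (s : Finset (Fin n)) : ∑ i ∈ s, x i ∈ cone x :=
  (coneM x).sum_mem fun i _ => cone_gen i

lemma cone_zsmul {a : G} (ha : a ∈ cone x) {k : ℤ} (hk : 0 ≤ k) : k • a ∈ cone x := by
  obtain ⟨m, rfl⟩ := Int.eq_ofNat_of_zero_le hk
  rw [natCast_zsmul]
  exact (coneM x).nsmul_mem ha m

lemma cone_p_sub (i : Fin n) : (∑ j, x j) - x i ∈ cone x := by
  have h := Finset.add_sum_erase Finset.univ x (Finset.mem_univ i)
  rw [← h, add_sub_cancel_left]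
  exact cone_sum _

lemma cone_induct {P : G → Prop} (h0 : P 0) (hs : ∀ a i, P a → P (a + x i)) {c : G}
    (hc : c ∈ cone x) : P c := by
  have h : c ∈ AddSubmonoid.closure (Set.range x) := by
    obtain ⟨c, rfl⟩ := hc
    refine AddSubmonoid.sum_mem _ fun i _ => ?_
    rw [natCast_zsmul]
    exact AddSubmonoid.nsmul_mem _ (AddSubmonoid.subset_closure (Set.mem_range_self i)) _
  clear hc
  induction h using AddSubmonoid.closure_induction_right with
  | zero => exact h0
  | add_right a _ b hb ih =>
    obtain ⟨i, rfl⟩ := hb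
    exact hs a i ih

lemma cone_large (hG2 : ∀ g : G, ∃ c : Fin n → ℤ, g = ∑ i, c i • x i) (g : G) :
    ∃ k : ℤ, g + k • (∑ i, x i) ∈ cone x := by
  obtain ⟨c, rfl⟩ := hG2 g
  refine ⟨∑ i, |c i|, ?_⟩
  rw [Finset.smul_sum, ← Finset.sum_add_distrib]
  refine (coneM x).sum_mem fun i _ => ?_
  rw [← add_smul]
  refine cone_zsmul (cone_gen i) ?_
  have h := Finset.single_le_sum (f := fun j => |c j|) (fun j _ => abs_nonneg _)
    (Finset.mem_univ i)
  have h2 := neg_abs_le (c i)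
  linarith

lemma neg_p_notMem (i : Fin n) (hi : x i ≠ 0)
    (hG3 : ∀ g : G, g ∈ cone x → -g ∈ cone x → g = 0) : -(∑ j, x j) ∉ cone x := by
  intro h
  have hp := hG3 _ (cone_sum _) h
  refine hi (hG3 _ (cone_gen i) ?_)
  have := cone_p_sub (x := x) i
  rwa [hp, zero_sub] at this

end Helpers

theorem mem_JG_iff (d : ℕ) (hd : 1 ≤ d) (G : Type*) [AddCommGroup G]
    (hfg : AddGroup.FG G) (π' : G →+ ℤ) (hsurj : Function.Surjective π')
    (hker : ∀ g : G, π' g = 0 ↔ IsOfFinAddOrder g)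
    (x : Fin (d + 1) → G) (hG1 : ∀ i, x i ≠ 0)
    (hG2 : ∀ g : G, ∃ c : Fin (d + 1) → ℤ, g = ∑ i, c i • x i)
    (hG3 : ∀ g : G, g ∈ cone x → -g ∈ cone x → g = 0)
    (J : Set G) :
    (J ∈ tilJSet x ∧ ∀ J' ∈ tilJSet x, J ⊆ J' → J' = J) ↔
      ((∀ g : G, ∃! n : ℤ, g + n • (∑ i, x i) ∈ J) ∧
        ∀ g ∈ J, ∀ i : Fin (d + 1), g + x i ∈ J ∨ g + x i - (∑ j, x j) ∈ J) := by
  set p := ∑ i, x i with hp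
  have hpc : p ∈ cone x := cone_sum _
  constructor
  · rintro ⟨hJ, hmax⟩
    set I : Set G := {g | ∃ h ∈ J, g - h ∈ cone x} with hI
    have hup : ∀ g c, g ∈ I → c ∈ cone x → g + c ∈ I := by
      rintro g c ⟨h, hh, hgh⟩ hc
      refine ⟨h, hh, ?_⟩
      have := cone_add hgh hc
      rwa [sub_add_eq_add_sub] at this
    have hJI : ∀ g, g ∈ J ↔ (g ∈ I ∧ g - p ∉ I) := by
      have h1 : {g | g ∈ I ∧ g - p ∉ I} = J := by
        refine hmax _ ?_ ?_
        · rintro g ⟨hg, hg'⟩ h ⟨hh, hh'⟩ hc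
          apply hg'
          have := hup h _ hh hc
          rwa [show h + (g - (h + ∑ i, x i)) = g - p by rw [← hp]; abel] at this
        · intro g hg
          refine ⟨⟨g, hg, by simpa using cone_zero⟩, ?_⟩
          rintro ⟨h, hh, hc⟩
          apply hJ g hg h hh
          rwa [show g - (h + ∑ i, x i) = g - p - h by rw [← hp]; abel]
      intro g
      conv_lhs => rw [← h1]
      rfl
    have hne : J.Nonempty := by
      by_contra hne
      rw [Set.not_nonempty_iff_eq_empty] at hne
      have h1 : ({0} : Set G) ∈ tilJSet x := by
        intro g hg h hh
        rw [Set.mem_singleton_iff] at hg hh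
        subst hg hh
        simpa using neg_p_notMem 0 (hG1 0) hG3
      have h2 := hmax {0} h1 (by simp [hne])
      simp [hne] at h2
    obtain ⟨h₀, hh₀⟩ := hne
    have hmono : ∀ g : G, ∀ a b : ℤ, a ≤ b → g + a • p ∈ I → g + b • p ∈ I := by
      intro g a b hab h
      have := hup _ _ h (cone_zsmul hpc (sub_nonneg.2 hab))
      rwa [add_assoc, ← add_smul, add_sub_cancel] at this
    refine ⟨fun g => ?_, ?_⟩
    · obtain ⟨k, hk⟩ := cone_large hG2 (g - h₀)
      obtain ⟨l, hl⟩ := cone_large hG2 (h₀ - g)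
      have hbig : g + k • p ∈ I := ⟨h₀, hh₀, by rwa [add_sub_right_comm]⟩
      have hsmall : g + (-l - 1) • p ∉ I := by
        rintro ⟨h, hh, hc⟩
        apply hJ h₀ hh₀ h hh
        have := cone_add hl hc
        rw [← hp] at this ⊢
        rwa [show h₀ - g + l • p + (g + (-l - 1) • p - h) = h₀ - (h + p) by
          rw [sub_smul, neg_smul, one_smul]; abel] at this
      have hbd : ∀ z : ℤ, g + z • p ∈ I → -l ≤ z := by
        intro z hz
        by_contra hlt
        exact hsmall (hmono g z _ (by omega) hz)
      obtain ⟨m, hm, hmin⟩ := Int.exists_least_of_bdd ⟨-l, hbd⟩ ⟨k, hbig⟩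
      have hsub : ∀ z : ℤ, g + z • p - p = g + (z - 1) • p := by
        intro z; rw [sub_smul, one_smul]; abel
      refine ⟨m, ?_, ?_⟩
      · show g + m • p ∈ J
        rw [hJI, hsub]
        exact ⟨hm, fun h => by have := hmin _ h; omega⟩
      · intro y hy
        replace hy : g + y • p ∈ J := hy
        rw [hJI, hsub] at hy
        have h1 := hmin y hy.1
        by_contra hne
        exact hy.2 (hmono g m _ (by omega) hm)
    · intro g hg i
      rw [hJI] at hg
      have h1 := hup _ _ hg.1 (cone_gen i)
      by_cases h2 : g + x i - p ∈ I
      · right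
        rw [hJI]
        refine ⟨h2, fun h3 => hg.2 ?_⟩
        have := hup _ _ h3 (cone_p_sub i)
        rwa [← hp, show g + x i - p - p + (p - x i) = g - p by abel] at this
      · left
        rw [hJI]
        exact ⟨h1, h2⟩
  · rintro ⟨huniq, hstep⟩
    have key : ∀ c, c ∈ cone x → ∀ h ∈ J, ∃ k : ℤ, 0 ≤ k ∧ h + c - k • p ∈ J := by
      intro c hc h hh
      refine cone_induct (P := fun c => ∃ k : ℤ, 0 ≤ k ∧ h + c - k • p ∈ J)
        ⟨0, le_rfl, by simpa using hh⟩ ?_ hc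
      · intro a i ih
        obtain ⟨k, hk, hm⟩ := ih
        rcases hstep _ hm i with h1 | h1
        · refine ⟨k, hk, ?_⟩
          rwa [show h + (a + x i) - k • p = h + a - k • p + x i by abel]
        · refine ⟨k + 1, by omega, ?_⟩
          rwa [show h + (a + x i) - (k + 1) • p = h + a - k • p + x i - p by
            rw [add_smul, one_smul]; abel]
    refine ⟨?_, ?_⟩
    · intro g hg h hh hc
      obtain ⟨k, hk, hm⟩ := key _ hc h hh
      rw [← hp] at hm
      have h1 := (huniq g).unique (y₁ := 0) (y₂ := -(k + 1)) (by simpa using hg) (by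
        rwa [show g + (-(k + 1)) • p = h + (g - (h + p)) - k • p by
          rw [neg_smul, add_smul, one_smul]; abel])
      omega
    · intro J' hJ' hsub
      refine Set.Subset.antisymm (fun g hg => ?_) hsub
      obtain ⟨m, hm, -⟩ := huniq g
      replace hm : g + m • p ∈ J := hm
      rcases lt_trichotomy m 0 with h | h | h
      · exfalso
        apply hJ' g hg _ (hsub hm)
        rw [← hp, show g - (g + m • p + p) = (-m - 1) • p by
          rw [sub_smul, neg_smul, one_smul]; abel]
        exact cone_zsmul hpc (by omega)
      · simpa [h] using hm
      · exfalso
        apply hJ' _ (hsub hm) g hg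
        rw [← hp, show g + m • p - (g + p) = (m - 1) • p by
          rw [sub_smul, one_smul]; abel]
        exact cone_zsmul hpc (by omega)

end Paper
end
end

section
/- Let G be a finitely generated abelian group of rank one and let x_0,…,x_d ∈ G satisfy (G1)–(G3), with p := Σ_{i=0}^d x_i. Then p is not a torsion element, the quotient group G/ℤp is finite, and there is a (necessarily unique) surjective group homomorphism L → G/ℤp sending α_i to x_i + ℤp for every 0 ≤ i ≤ d. -/
open scoped Classical

noncomputable section

namespace Paper

theorem aux_sub_one {d : ℕ} (k : Fin d) : (k.succ : Fin (d + 1)) - 1 = k.castSucc := by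
  rw [sub_eq_iff_eq_add, Fin.coeSucc_eq_succ]

theorem aux_alpha_gen (d : ℕ) : AddSubgroup.closure (Set.range (alpha d)) = ⊤ := by
  have key : ∀ i : Fin (d + 1), ∃ w : L d, w ∈ AddSubgroup.closure (Set.range (alpha d)) ∧
      (w : V d) = Pi.single i 1 - Pi.single 0 1 := by
    intro i
    induction i using Fin.induction with
    | zero => exact ⟨0, zero_mem _, by simp⟩
    | succ k ih =>
      obtain ⟨w, hw, hw'⟩ := ih
      refine ⟨alpha d k.succ + w,
        add_mem (AddSubgroup.subset_closure ⟨_, rfl⟩) hw, ?_⟩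
      rw [AddSubgroup.coe_add, hw']
      simp only [alpha, aux_sub_one]
      abel
  choose w hw hw' using key
  rw [eq_top_iff]
  intro v _
  have hv : v = ∑ i, (v : V d) i • w i := by
    apply Subtype.ext
    rw [AddSubgroup.val_finsetSum]
    have h0 : ∑ i, (v : V d) i = 0 := v.2
    simp only [AddSubgroup.coe_zsmul, hw', smul_sub, Finset.sum_sub_distrib]
    rw [← Finset.sum_smul, h0, zero_smul, sub_zero]
    ext j
    simp [Finset.sum_apply, Pi.single_apply]
  rw [hv]
  exact sum_mem fun i _ => zsmul_mem (hw i) _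

theorem aux_step {H : Type*} [AddCommGroup H] {d : ℕ} (x : Fin (d + 1) → H)
    (hx : ∑ i, x i = 0) (i : Fin (d + 1)) :
    (∑ j ∈ Finset.Iic i, x j) - ∑ j ∈ Finset.Iic (i - 1), x j = x i := by
  induction i using Fin.cases with
  | zero =>
    have h1 : Finset.Iic (0 : Fin (d + 1)) = {0} := by ext j; simp
    have h2 : Finset.Iic ((0 : Fin (d + 1)) - 1) = Finset.univ := by
      have h3 : (0 : Fin (d + 1)) - 1 = Fin.last d := by
        rw [sub_eq_iff_eq_add, Fin.last_add_one]
      ext j; simp only [h3, Finset.mem_Iic, Fin.le_last, Finset.mem_univ]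
    rw [h1, h2, hx]; simp
  | succ k =>
    rw [aux_sub_one]
    have h1 : Finset.Iic k.succ = insert k.succ (Finset.Iic k.castSucc) := by
      ext j
      simp only [Finset.mem_Iic, Finset.mem_insert, Fin.le_def, Fin.ext_iff, Fin.val_succ,
        Fin.val_castSucc]
      omega
    rw [h1, Finset.sum_insert (by simp [Fin.le_def])]
    abel

theorem p_not_torsion_quotient_finite (d : ℕ) (hd : 1 ≤ d) (G : Type*) [AddCommGroup G]
    (hfg : AddGroup.FG G) (π' : G →+ ℤ) (hsurj : Function.Surjective π')
    (hker : ∀ g : G, π' g = 0 ↔ IsOfFinAddOrder g)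
    (x : Fin (d + 1) → G) (hG1 : ∀ i, x i ≠ 0)
    (hG2 : ∀ g : G, ∃ c : Fin (d + 1) → ℤ, g = ∑ i, c i • x i)
    (hG3 : ∀ g : G, g ∈ cone x → -g ∈ cone x → g = 0) :
    ¬ IsOfFinAddOrder (∑ i, x i) ∧
    Finite (G ⧸ AddSubgroup.zmultiples (∑ i, x i)) ∧
    ∃ ψ : L d →+ G ⧸ AddSubgroup.zmultiples (∑ i, x i),
      Function.Surjective ψ ∧
      (∀ i, ψ (alpha d i) = QuotientAddGroup.mk (x i)) ∧
      ∀ ψ' : L d →+ G ⧸ AddSubgroup.zmultiples (∑ i, x i),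
        (∀ i, ψ' (alpha d i) = QuotientAddGroup.mk (x i)) → ψ' = ψ := by
  have hp : ¬ IsOfFinAddOrder (∑ i, x i) := by
    intro h
    obtain ⟨n, hn, hn0⟩ := isOfFinAddOrder_iff_nsmul_eq_zero.1 h
    apply hG1 0
    apply hG3
    · exact ⟨Pi.single 0 1, by simp [Pi.single_apply]⟩
    · refine ⟨fun j => if j = 0 then n - 1 else n, ?_⟩
      have h1 : ∀ j : Fin (d + 1), (((if j = 0 then n - 1 else n : ℕ) : ℤ)) • x j
          = n • x j - if j = 0 then x j else 0 := by
        intro j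
        split_ifs
        · rw [Nat.cast_sub hn, sub_smul]; simp
        · simp
      simp only [h1]
      rw [Finset.sum_sub_distrib, ← Finset.smul_sum, hn0]
      simp
  refine ⟨hp, ?_, ?_⟩
  · have hpi : π' (∑ i, x i) ≠ 0 := fun h => hp ((hker _).1 h)
    set p := ∑ i, x i with hpdef
    have : AddGroup.FG G := hfg
    have : AddGroup.FG (G ⧸ AddSubgroup.zmultiples p) := inferInstance
    have : Module.Finite ℤ (G ⧸ AddSubgroup.zmultiples p) :=
      Module.Finite.iff_addGroup_fg.2 inferInstance
    apply AddCommGroup.finite_of_fg_isAddTorsion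
    intro g
    induction g using QuotientAddGroup.induction_on with
    | H g =>
    have h0 : π' (π' p • g - π' g • p) = 0 := by
      simp [mul_comm]
    obtain ⟨n, hn, hn0⟩ := isOfFinAddOrder_iff_nsmul_eq_zero.1 ((hker _).1 h0)
    rw [isOfFinAddOrder_iff_zsmul_eq_zero]
    refine ⟨n * π' p, mul_ne_zero (by exact_mod_cast hn.ne') hpi, ?_⟩
    rw [← QuotientAddGroup.mk_zsmul, QuotientAddGroup.eq_zero_iff]
    refine ⟨n * π' g, ?_⟩
    rw [smul_sub, sub_eq_zero] at hn0
    simp only [mul_smul, natCast_zsmul]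
    exact hn0.symm
  · set p := ∑ i, x i with hpdef
    let q : Fin (d + 1) → G ⧸ AddSubgroup.zmultiples p := fun i => QuotientAddGroup.mk (x i)
    have hq : ∑ i, q i = 0 := by
      have : ∑ i, q i = QuotientAddGroup.mk' (AddSubgroup.zmultiples p) p := by
        exact (map_sum (QuotientAddGroup.mk' (AddSubgroup.zmultiples p)) x Finset.univ).symm
      rw [this]
      exact (QuotientAddGroup.eq_zero_iff _).2 (AddSubgroup.mem_zmultiples p)
    let ψ := (PhiG d fun i => ∑ j ∈ Finset.Iic i, q j).comp (L d).subtype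
    have hψ : ∀ i, ψ (alpha d i) = q i := by
      intro i
      rw [← aux_step q hq i]
      simp [ψ, PhiG, alpha, Pi.single_apply, sub_smul, ite_smul]
    refine ⟨ψ, ?_, hψ, ?_⟩
    · intro g
      induction g using QuotientAddGroup.induction_on with
      | H g =>
      obtain ⟨c, rfl⟩ := hG2 g
      refine ⟨∑ i, c i • alpha d i, ?_⟩
      have : (QuotientAddGroup.mk (∑ i, c i • x i) : G ⧸ AddSubgroup.zmultiples p)
        = QuotientAddGroup.mk' (AddSubgroup.zmultiples p) (∑ i, c i • x i) := rfl
      rw [this, map_sum, map_sum]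
      refine Finset.sum_congr rfl fun i _ => ?_
      rw [map_zsmul, map_zsmul, hψ]
      rfl
    · intro ψ' h'
      refine AddMonoidHom.eq_of_eqOn_dense (aux_alpha_gen d) ?_
      rintro _ ⟨i, rfl⟩
      rw [h', hψ]

end Paper
end
end

section
/- Let G be a finitely generated abelian group of rank one and let x_0,…,x_d ∈ G satisfy (G1)–(G3), with p := Σ_{i=0}^d x_i. Let B ⊆ L be the kernel of the surjective homomorphism L → G/ℤp sending α_i to x_i + ℤp, and m := #(G/ℤp) = [L : B]. Let π' : G → ℤ be a surjective group homomorphism whose kernel is the torsion subgroup of G and with m' := π'(p) > 0. Then m' divides m, and setting γ_i := (m/m')·π'(x_i) for 0 ≤ i ≤ d, one has: γ_i > 0 for all i, Σ_{i=0}^d γ_i = m, and for every (m_i)_{i=0}^d ∈ ℤ^{d+1} with Σ_{i=0}^d m_iα_i ∈ B one has Σ_{i=0}^d m_iγ_i ∈ mℤ. -/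
open scoped Classical

noncomputable section

namespace Paper

theorem gamma_construction (d : ℕ) (hd : 1 ≤ d) (G : Type*) [AddCommGroup G]
    (hfg : AddGroup.FG G) (π' : G →+ ℤ) (hsurj : Function.Surjective π')
    (hker : ∀ g : G, π' g = 0 ↔ IsOfFinAddOrder g)
    (x : Fin (d + 1) → G) (hG1 : ∀ i, x i ≠ 0)
    (hG2 : ∀ g : G, ∃ c : Fin (d + 1) → ℤ, g = ∑ i, c i • x i)
    (hG3 : ∀ g : G, g ∈ cone x → -g ∈ cone x → g = 0)
    (hm' : 0 < π' (∑ i, x i))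
    (ψ : L d →+ G ⧸ AddSubgroup.zmultiples (∑ i, x i))
    (hψsurj : Function.Surjective ψ)
    (hψ : ∀ i, ψ (alpha d i) = QuotientAddGroup.mk (x i))
    (m : ℕ) (hm : m = Nat.card (G ⧸ AddSubgroup.zmultiples (∑ i, x i)))
    (γ : Fin (d + 1) → ℤ)
    (hγdef : ∀ i, γ i = ((m : ℤ) / π' (∑ j, x j)) * π' (x i)) :
    (π' (∑ i, x i) ∣ (m : ℤ)) ∧
    (∀ i, 0 < γ i) ∧
    (∑ i, γ i) = (m : ℤ) ∧
    (∀ m' : Fin (d + 1) → ℤ, (∑ i, m' i • alpha d i) ∈ ψ.ker →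
      (m : ℤ) ∣ ∑ i, m' i * γ i) := by
  have key : ∀ (i j : Fin (d + 1)) (a b : ℕ), 0 < a → a • x i + b • x j = 0 → False := by
    intro i j a b ha h
    refine hG1 i (hG3 _ ⟨Pi.single i 1, ?_⟩ ⟨Pi.single i (a - 1) + Pi.single j b, ?_⟩)
    · simp [Pi.single_apply, ite_smul]
    · obtain ⟨a, rfl⟩ : ∃ a', a = a' + 1 := ⟨a - 1, by omega⟩
      have e : ∑ k, (((Pi.single i (a + 1 - 1) + Pi.single j b : Fin (d + 1) → ℕ) k : ℕ) : ℤ) • x k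
          = a • x i + b • x j := by
        simp [Pi.single_apply, add_smul, Finset.sum_add_distrib, ite_smul]
      rw [e, neg_eq_iff_add_eq_zero, ← h, add_smul, one_smul]
      abel
  have hpos : ∀ i, 0 < π' (x i) := by
    intro i
    by_contra hi
    rw [not_lt] at hi
    obtain ⟨j, hj⟩ : ∃ j, 0 < π' (x j) := by
      by_contra hne
      push Not at hne
      rw [map_sum] at hm'
      exact absurd hm' (not_lt.mpr (Finset.sum_nonpos fun j _ => hne j))
    obtain ⟨a, ha⟩ := Int.eq_ofNat_of_zero_le hj.le
    obtain ⟨b, hb⟩ := Int.eq_ofNat_of_zero_le (neg_nonneg.mpr hi)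
    have ht : IsOfFinAddOrder (a • x i + b • x j) := by
      rw [← hker]
      simp only [map_add, map_nsmul, nsmul_eq_mul]
      have : π' (x i) = -b := by omega
      rw [ha, this]
      ring
    obtain ⟨n, hn, hn0⟩ := isOfFinAddOrder_iff_nsmul_eq_zero.mp ht
    refine key i j (n * a) (n * b) (Nat.mul_pos hn (by omega)) ?_
    rw [← hn0, smul_add, mul_smul, mul_smul]
  set p := ∑ i, x i with hp
  have htor : AddMonoid.IsTorsion (G ⧸ AddSubgroup.zmultiples p) := by
    intro q
    obtain ⟨g, rfl⟩ := QuotientAddGroup.mk_surjective q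
    have ht : IsOfFinAddOrder ((π' p) • g - (π' g) • p) := by
      rw [← hker]
      simp only [map_sub, map_zsmul, smul_eq_mul]
      ring
    obtain ⟨n, hn, hn0⟩ := isOfFinAddOrder_iff_nsmul_eq_zero.mp ht
    obtain ⟨a, ha⟩ := Int.eq_ofNat_of_zero_le hm'.le
    refine isOfFinAddOrder_iff_nsmul_eq_zero.mpr ⟨n * a, Nat.mul_pos hn (by omega), ?_⟩
    rw [← QuotientAddGroup.mk_nsmul, QuotientAddGroup.eq_zero_iff,
      AddSubgroup.mem_zmultiples_iff]
    refine ⟨n * π' g, ?_⟩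
    rw [smul_sub, sub_eq_zero, ha] at hn0
    rw [mul_smul, mul_smul, natCast_zsmul, ← hn0, natCast_zsmul]
  haveI := hfg
  haveI : Finite (G ⧸ AddSubgroup.zmultiples p) :=
    AddCommGroup.finite_of_fg_torsion _ htor
  have hmpos : 0 < m := hm ▸ Nat.card_pos
  have hdvd : π' p ∣ (m : ℤ) := by
    let φ : G ⧸ AddSubgroup.zmultiples p →+ ℤ ⧸ AddSubgroup.zmultiples (π' p) :=
      QuotientAddGroup.map _ _ π' (by
        rw [AddSubgroup.zmultiples_le]
        exact AddSubgroup.mem_zmultiples _)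
    have hφ : Function.Surjective φ := by
      intro q
      obtain ⟨z, rfl⟩ := QuotientAddGroup.mk_surjective q
      obtain ⟨g, rfl⟩ := hsurj z
      exact ⟨QuotientAddGroup.mk g, rfl⟩
    have h := AddSubgroup.card_dvd_of_surjective φ hφ
    rw [← hm] at h
    have hc : Nat.card (ℤ ⧸ AddSubgroup.zmultiples (π' p)) = (π' p).natAbs :=
      Int.index_zmultiples _
    rw [hc] at h
    exact Int.natAbs_dvd.mp (Int.natCast_dvd_natCast.mpr h)
  have hmul : ((m : ℤ) / π' p) * π' p = m := Int.ediv_mul_cancel hdvd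
  refine ⟨hdvd, ?_, ?_, ?_⟩
  · intro i
    rw [hγdef]
    refine mul_pos ?_ (hpos i)
    refine pos_of_mul_pos_left ?_ hm'.le
    rw [hmul]
    exact_mod_cast hmpos
  · simp_rw [hγdef]
    rw [← Finset.mul_sum, ← map_sum, ← hp, hmul]
  · intro c hc
    rw [AddMonoidHom.mem_ker, map_sum] at hc
    have h2 : (QuotientAddGroup.mk (∑ i, c i • x i) : G ⧸ AddSubgroup.zmultiples p) = 0 := by
      rw [← hc, QuotientAddGroup.mk_sum]
      refine Finset.sum_congr rfl fun i _ => ?_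
      rw [map_zsmul, hψ, QuotientAddGroup.mk_zsmul]
    rw [QuotientAddGroup.eq_zero_iff, AddSubgroup.mem_zmultiples_iff] at h2
    obtain ⟨k, hk⟩ := h2
    have h3 := congrArg π' hk
    simp only [map_sum, map_zsmul, smul_eq_mul] at h3
    refine ⟨k, ?_⟩
    simp_rw [hγdef]
    calc ∑ i, c i * ((m : ℤ) / π' p * π' (x i))
        = ((m : ℤ) / π' p) * ∑ i, c i * π' (x i) := by
          rw [Finset.mul_sum]
          exact Finset.sum_congr rfl fun i _ => by ring
      _ = ((m : ℤ) / π' p) * π' p * k := by rw [← h3]; ring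
      _ = m * k := by rw [hmul]

end Paper
end
end

section
/- Let G be a finitely generated abelian group of rank one, let x_0,…,x_d ∈ G satisfy (G1)–(G3), and let B, m, and γ = (γ_i)_{i=0}^d be constructed from (G, (x_i)) as described. Define Φ : ℤ^{d+1} → ℤ ⊕ L/B by Φ(e_i) := (γ_i, α_i + B). Then there is a group isomorphism ψ : G → Im Φ with ψ(x_i) = Φ(e_i) for all 0 ≤ i ≤ d; equivalently, the homomorphism Φ' : ℤ^{d+1} → G with Φ'(e_i) = x_i satisfies Ker Φ = Ker Φ'. -/
open scoped Classical

noncomputable section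

namespace Paper

/-- The quotient by the multiples of p is finite, of order divisible by the value at p. -/
theorem quot_finite_and_le {G : Type*} [AddCommGroup G] (hfg : AddGroup.FG G) (π' : G →+ ℤ)
    (hsurj : Function.Surjective π') (hker : ∀ g : G, π' g = 0 ↔ IsOfFinAddOrder g)
    (p : G) (hp : 0 < π' p) :
    π' p ∣ (Nat.card (G ⧸ AddSubgroup.zmultiples p) : ℤ) ∧
      0 < Nat.card (G ⧸ AddSubgroup.zmultiples p) := by
  have hfin : Finite (G ⧸ AddSubgroup.zmultiples p) := by
    have : AddGroup.FG (G ⧸ AddSubgroup.zmultiples p) :=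
      AddGroup.fg_of_surjective (f := QuotientAddGroup.mk' (AddSubgroup.zmultiples p))
        (QuotientAddGroup.mk'_surjective _)
    have : Module.Finite ℤ (G ⧸ AddSubgroup.zmultiples p) :=
      Module.Finite.iff_addGroup_fg.mpr this
    refine Module.finite_of_fg_torsion _ ?_
    intro q
    obtain ⟨g, rfl⟩ := QuotientAddGroup.mk_surjective q
    have h0 : π' (π' p • g - π' g • p) = 0 := by
      simp [mul_comm]
    obtain ⟨n, hn, hn0⟩ := isOfFinAddOrder_iff_nsmul_eq_zero.mp ((hker _).mp h0)
    refine ⟨⟨(n : ℤ) * π' p, mem_nonZeroDivisors_of_ne_zero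
      (mul_ne_zero (by exact_mod_cast hn.ne') hp.ne')⟩, ?_⟩
    change ((n : ℤ) * π' p) • (QuotientAddGroup.mk g : G ⧸ AddSubgroup.zmultiples p) = 0
    rw [← QuotientAddGroup.mk_zsmul, QuotientAddGroup.eq_zero_iff,
      AddSubgroup.mem_zmultiples_iff]
    refine ⟨(n : ℤ) * π' g, ?_⟩
    rw [← natCast_zsmul, smul_sub, sub_eq_zero, smul_smul, smul_smul] at hn0
    exact hn0.symm
  refine ⟨?_, Nat.card_pos⟩
  have hle : AddSubgroup.zmultiples p ≤ (AddSubgroup.zmultiples (π' p)).comap π' := by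
    rw [AddSubgroup.zmultiples_le]
    exact AddSubgroup.mem_zmultiples _
  have hs : Function.Surjective (QuotientAddGroup.map (AddSubgroup.zmultiples p)
      (AddSubgroup.zmultiples (π' p)) π' hle) := by
    intro q
    obtain ⟨k, rfl⟩ := QuotientAddGroup.mk_surjective q
    obtain ⟨g, rfl⟩ := hsurj k
    exact ⟨QuotientAddGroup.mk g, rfl⟩
  have h := AddSubgroup.card_dvd_of_surjective _ hs
  have hc : Nat.card (ℤ ⧸ AddSubgroup.zmultiples (π' p)) = (π' p).natAbs := by
    rw [Nat.card_congr (Int.quotientZMultiplesEquivZMod (π' p)).toEquiv, Nat.card_zmod]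
  rw [hc] at h
  exact Int.natAbs_dvd.mp (by exact_mod_cast h)

theorem recover_G_from_Bgamma (d : ℕ) (hd : 1 ≤ d) (G : Type*) [AddCommGroup G]
    (hfg : AddGroup.FG G) (π' : G →+ ℤ) (hsurj : Function.Surjective π')
    (hker : ∀ g : G, π' g = 0 ↔ IsOfFinAddOrder g)
    (x : Fin (d + 1) → G) (hG1 : ∀ i, x i ≠ 0)
    (hG2 : ∀ g : G, ∃ c : Fin (d + 1) → ℤ, g = ∑ i, c i • x i)
    (hG3 : ∀ g : G, g ∈ cone x → -g ∈ cone x → g = 0)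
    (hm' : 0 < π' (∑ i, x i))
    (ψ : L d →+ G ⧸ AddSubgroup.zmultiples (∑ i, x i))
    (hψsurj : Function.Surjective ψ)
    (hψ : ∀ i, ψ (alpha d i) = QuotientAddGroup.mk (x i))
    (m : ℕ) (hm : m = Nat.card (G ⧸ AddSubgroup.zmultiples (∑ i, x i)))
    (γ : Fin (d + 1) → ℤ)
    (hγdef : ∀ i, γ i = ((m : ℤ) / π' (∑ j, x j)) * π' (x i)) :
    (Phi d ψ.ker γ).ker = (PhiG d x).ker ∧
    ∃ e : G ≃+ GB d ψ.ker γ, ∀ i, e (x i) = xE d ψ.ker γ i := by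
  classical
  obtain ⟨hdvd, hpos⟩ := quot_finite_and_le hfg π' hsurj hker (∑ i, x i) hm'
  rw [← hm] at hdvd hpos
  have hq : (m : ℤ) / π' (∑ j, x j) ≠ 0 := by
    intro h0
    have := Int.ediv_mul_cancel hdvd
    rw [h0, zero_mul] at this
    omega
  have hkk : (Phi d ψ.ker γ).ker = (PhiG d x).ker := by
    ext c
    have e1 : ∑ i, c i * γ i = ((m : ℤ) / π' (∑ j, x j)) * π' (∑ i, c i • x i) := by
      rw [map_sum π' (fun i => c i • x i), Finset.mul_sum]
      refine Finset.sum_congr rfl fun i _ => ?_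
      rw [hγdef, map_zsmul, smul_eq_mul]
      ring
    have e2 : ψ (∑ i, c i • alpha d i) = QuotientAddGroup.mk (∑ i, c i • x i) := by
      rw [map_sum]
      change _ = QuotientAddGroup.mk' _ (∑ i, c i • x i)
      rw [map_sum]
      refine Finset.sum_congr rfl fun i _ => ?_
      rw [map_zsmul, map_zsmul, hψ]
      rfl
    have e3 : c ∈ (Phi d ψ.ker γ).ker ↔
        (∑ i, c i * γ i = 0 ∧ ∑ i, c i • alpha d i ∈ ψ.ker) := by
      rw [← QuotientAddGroup.eq_zero_iff (N := ψ.ker)]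
      exact Prod.mk_inj
    have e4 : c ∈ (PhiG d x).ker ↔ ∑ i, c i • x i = 0 := Iff.rfl
    rw [e3, e4, AddMonoidHom.mem_ker, e1, e2, QuotientAddGroup.eq_zero_iff,
      AddSubgroup.mem_zmultiples_iff]
    constructor
    · rintro ⟨h1, n, hn⟩
      have h2 := (mul_eq_zero.mp h1).resolve_left hq
      rw [← hn, map_zsmul, smul_eq_mul] at h2
      have h3 := (mul_eq_zero.mp h2).resolve_right hm'.ne'
      rw [← hn, h3, zero_smul]
    · intro h
      rw [h]
      exact ⟨by simp, 0, by simp⟩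
  refine ⟨hkk, ?_⟩
  have hs : Function.Surjective (PhiG d x) := fun g => by
    obtain ⟨c, hc⟩ := hG2 g
    exact ⟨c, hc.symm⟩
  have hx : ∀ i, PhiG d x (Pi.single i 1) = x i := fun i => by
    change ∑ j, (Pi.single i 1 : V d) j • x j = x i
    rw [Finset.sum_eq_single i]
    · simp
    · intro j _ hj
      simp [hj]
    · simp
  let e1 := QuotientAddGroup.quotientKerEquivOfSurjective (PhiG d x) hs
  refine ⟨(e1.symm.trans (QuotientAddGroup.quotientAddEquivOfEq hkk.symm)).trans
    (QuotientAddGroup.quotientKerEquivRange (Phi d ψ.ker γ)), fun i => ?_⟩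
  have h1 : e1.symm (x i) = QuotientAddGroup.mk (Pi.single i 1) := by
    rw [AddEquiv.symm_apply_eq]
    exact (hx i).symm
  rw [AddEquiv.trans_apply, AddEquiv.trans_apply, h1]
  rfl

end Paper
end
end

section
/- The assignment (B, γ) ↦ class of (G(B,γ), (Φ(e_i))_{i=0}^d) is a bijection from the set of pairs (B, γ), where B ⊆ L is a subgroup of finite index and γ ∈ ℤ_{>0}^{d+1} satisfies Σ_{i=0}^d γ_i = [L : B] and (Σ_{i=0}^d m_iα_i ∈ B ⟹ Σ_{i=0}^d m_iγ_i ∈ [L : B]·ℤ for all (m_i) ∈ ℤ^{d+1}), onto the set of isomorphism classes of pairs (G, (x_i)_{i=0}^d), where G is a finitely generated abelian group of rank one and x_0,…,x_d ∈ G satisfy (G1)–(G3); here two pairs (G, (x_i)) and (G', (x_i')) are isomorphic if there is a group isomorphism G → G' sending x_i to x_i' for all i. -/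
open scoped Classical

noncomputable section

namespace Paper

/-- The homomorphism `v ↦ ∑ v_i α_i`. -/
def Ah (d : ℕ) : V d →+ L d := PhiG d (alpha d)

lemma Ah_apply (d : ℕ) (v : V d) : Ah d v = ∑ i, v i • alpha d i := rfl

lemma Ah_coord (d : ℕ) (v : V d) (j : Fin (d + 1)) :
    (Ah d v : V d) j = v j - v (j + 1) := by
  rw [Ah_apply, AddSubgroup.val_finsetSum, Finset.sum_apply]
  simp only [AddSubgroup.coe_zsmul, alpha, Pi.smul_apply, Pi.sub_apply, smul_eq_mul, mul_sub,
    Finset.sum_sub_distrib, Pi.single_apply]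
  congr 1
  · simp
  · rw [Finset.sum_eq_single (j + 1)]
    · simp
    · intro b _ hb
      rw [if_neg]
      · simp
      · intro h
        apply hb
        rw [h]
        simp
    · simp

lemma Ah_ker (d : ℕ) (v : V d) (h : Ah d v = 0) (i : Fin (d + 1)) : v i = v 0 := by
  induction i using Fin.induction with
  | zero => rfl
  | succ k ih =>
    have h1 := Ah_coord d v k.castSucc
    rw [h, Fin.coeSucc_eq_succ] at h1
    simp at h1
    linarith

lemma Ah_ones (d : ℕ) (n : ℤ) : Ah d (fun _ => n) = 0 := by
  apply Subtype.ext
  funext j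
  rw [Ah_coord]
  simp

lemma Ah_surj (d : ℕ) : Function.Surjective (Ah d) := by
  rintro ⟨w, hw⟩
  have hw' : ∑ i, w i = 0 := hw
  let f : ℕ → ℤ := fun k => if h : k < d + 1 then w ⟨k, h⟩ else 0
  have hf : ∀ j : Fin (d + 1), f j = w j := fun j => by
    simp only [f]
    rw [dif_pos j.isLt]
  refine ⟨fun j => - ∑ k ∈ Finset.range (j : ℕ), f k, ?_⟩
  apply Subtype.ext
  funext j
  rw [Ah_coord]
  change _ = w j
  have htot : ∑ k ∈ Finset.range (d + 1), f k = 0 := by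
    rw [Finset.sum_range, ← hw']
    exact Finset.sum_congr rfl fun i _ => hf i
  rw [← hf j]
  induction j using Fin.lastCases with
  | last =>
    rw [Finset.sum_range_succ] at htot
    simp
    linarith
  | cast k =>
    rw [Fin.coeSucc_eq_succ, Fin.val_succ, Finset.sum_range_succ]
    simp

lemma ofnorm {G : Type*} [AddCommGroup G] (f : G →+ ℤ) (g0 : G) (h0 : f g0 ≠ 0) :
    ∃ π : G →+ ℤ, Function.Surjective π ∧ ∀ g, π g = 0 ↔ f g = 0 := by
  obtain ⟨a, ha⟩ := Int.subgroup_cyclic f.range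
  have ha0 : a ≠ 0 := by
    rintro rfl
    have : f g0 ∈ f.range := ⟨g0, rfl⟩
    rw [ha, AddSubgroup.mem_closure_singleton] at this
    obtain ⟨k, hk⟩ := this
    apply h0
    rw [← hk, smul_zero]
  have hdvd : ∀ g, ∃ k, f g = k * a := by
    intro g
    have : f g ∈ f.range := ⟨g, rfl⟩
    rw [ha, AddSubgroup.mem_closure_singleton] at this
    obtain ⟨k, hk⟩ := this
    exact ⟨k, by rw [← hk]; simp⟩
  choose k hk using hdvd
  refine ⟨AddMonoidHom.mk' k ?_, ?_, ?_⟩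
  · intro x y
    apply mul_right_cancel₀ ha0
    rw [add_mul, ← hk, ← hk, ← hk, map_add]
  · intro n
    have : n * a ∈ f.range := by
      rw [ha, AddSubgroup.mem_closure_singleton]
      exact ⟨n, by simp⟩
    obtain ⟨g, hg⟩ := this
    refine ⟨g, ?_⟩
    apply mul_right_cancel₀ ha0
    change k g * a = _
    rw [← hk, hg]
  · intro g
    change k g = 0 ↔ _
    rw [hk]
    simp [ha0]

lemma Phi_fst (d : ℕ) (B : AddSubgroup (L d)) (γ : Fin (d + 1) → ℤ) (v : V d) :
    (Phi d B γ v).1 = ∑ i, v i * γ i := rfl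

lemma Phi_snd (d : ℕ) (B : AddSubgroup (L d)) (γ : Fin (d + 1) → ℤ) (v : V d) :
    (Phi d B γ v).2 = (QuotientAddGroup.mk (Ah d v) : L d ⧸ B) := rfl

lemma Phi_eq_zero (d : ℕ) (B : AddSubgroup (L d)) (γ : Fin (d + 1) → ℤ) (v : V d) :
    Phi d B γ v = 0 ↔ ∑ i, v i * γ i = 0 ∧ Ah d v ∈ B := by
  rw [Prod.ext_iff, Phi_fst, Phi_snd]
  simp

lemma xE_sum (d : ℕ) (B : AddSubgroup (L d)) (γ : Fin (d + 1) → ℤ) (v : V d) :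
    ((∑ i, v i • xE d B γ i : GB d B γ) : ℤ × (L d ⧸ B)) = Phi d B γ v := by
  rw [AddSubgroup.val_finsetSum]
  conv_rhs => rw [pi_eq_sum_univ' v]
  rw [map_sum]
  refine Finset.sum_congr rfl fun i _ => ?_
  rw [map_zsmul]
  rw [AddSubgroup.coe_zsmul]
  congr 2

lemma part1 (d : ℕ) (B : AddSubgroup (L d)) (γ : Fin (d + 1) → ℤ) (h : GoodBgamma d B γ) :
    GoodPair d (GB d B γ) (xE d B γ) := by
  obtain ⟨hB, hpos, hsum, hdiv⟩ := h
  have hx1 : ∀ i, ((xE d B γ i : GB d B γ) : ℤ × (L d ⧸ B)).1 = γ i := by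
    intro i
    change ∑ j, (Pi.single i (1 : ℤ) : V d) j * γ j = γ i
    simp [Pi.single_apply]
  have hne : ∀ i, xE d B γ i ≠ 0 := by
    intro i hi
    have := hx1 i
    rw [hi] at this
    have h2 := hpos i
    rw [← this] at h2
    simp at h2
  let f : GB d B γ →+ ℤ := (AddMonoidHom.fst ℤ (L d ⧸ B)).comp (GB d B γ).subtype
  refine ⟨?_, ?_, hne, ?_, ?_⟩
  · have hfin : Module.Finite ℤ (V d) := inferInstance
    have hfg : AddGroup.FG (V d) := Module.Finite.iff_addGroup_fg.1 hfin
    exact AddGroup.fg_range _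
  · obtain ⟨π, hπ, hπ0⟩ := ofnorm f (xE d B γ 0) (by
      change ((xE d B γ 0 : GB d B γ) : ℤ × (L d ⧸ B)).1 ≠ 0
      rw [hx1]; exact (hpos 0).ne')
    refine ⟨π, hπ, fun g => ?_⟩
    rw [isOfFinAddOrder_iff_nsmul_eq_zero]
    constructor
    · intro hg
      have hg := (hπ0 g).1 hg
      refine ⟨B.index, Nat.pos_of_ne_zero hB.index_ne_zero, ?_⟩
      apply Subtype.ext
      apply Prod.ext
      · have : f (B.index • g) = 0 := by rw [map_nsmul, hg, smul_zero]
        exact this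
      · change B.index • (g : ℤ × (L d ⧸ B)).2 = 0
        obtain ⟨y, hy⟩ := QuotientAddGroup.mk_surjective (g : ℤ × (L d ⧸ B)).2
        rw [← hy, ← QuotientAddGroup.mk_nsmul, QuotientAddGroup.eq_zero_iff]
        exact B.nsmul_index_mem y
    · rintro ⟨n, hn, hg⟩
      have : π (n • g) = 0 := by rw [hg, map_zero]
      rw [map_nsmul] at this
      simpa [hn.ne'] using this
  · rintro ⟨_, v, rfl⟩
    refine ⟨v, ?_⟩
    apply Subtype.ext
    rw [xE_sum]
  · rintro g ⟨c, hc⟩ ⟨c', hc'⟩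
    have e1 : f g = ∑ i, (c i : ℤ) * γ i := by
      change (g : ℤ × (L d ⧸ B)).1 = _
      rw [hc, xE_sum d B γ (fun i => (c i : ℤ))]; rfl
    have e2 : f (-g) = ∑ i, (c' i : ℤ) * γ i := by
      change ((-g : GB d B γ) : ℤ × (L d ⧸ B)).1 = _
      rw [hc', xE_sum d B γ (fun i => (c' i : ℤ))]; rfl
    have p2 : 0 ≤ ∑ i, (c' i : ℤ) * γ i :=
      Finset.sum_nonneg fun i _ => mul_nonneg (by positivity) (hpos i).le
    have p1 : ∀ i ∈ Finset.univ, 0 ≤ (c i : ℤ) * γ i :=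
      fun i _ => mul_nonneg (by positivity) (hpos i).le
    rw [map_neg, e1] at e2
    have z : ∑ i, (c i : ℤ) * γ i = 0 := le_antisymm (by linarith) (Finset.sum_nonneg p1)
    rw [Finset.sum_eq_zero_iff_of_nonneg p1] at z
    rw [hc]
    refine Finset.sum_eq_zero fun i hi => ?_
    have := z i hi
    have h3 : (c i : ℤ) = 0 := by simpa [(hpos i).ne'] using this
    rw [h3, zero_smul]

lemma sum_sub_const (d : ℕ) (γ : Fin (d + 1) → ℤ) (v : V d) (n : ℤ) :
    ∑ i, (v - (fun _ => n : V d) : V d) i * γ i = ∑ i, v i * γ i - n * ∑ i, γ i := by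
  rw [Finset.mul_sum, ← Finset.sum_sub_distrib]
  exact Finset.sum_congr rfl fun i _ => by simp [sub_mul]

lemma mem_B_iff (d : ℕ) (B : AddSubgroup (L d)) (γ : Fin (d + 1) → ℤ) (h : GoodBgamma d B γ) :
    B = (Phi d B γ).ker.map (Ah d) := by
  obtain ⟨hB, hpos, hsum, hdiv⟩ := h
  ext b
  constructor
  · intro hb
    obtain ⟨v, rfl⟩ := Ah_surj d b
    obtain ⟨n, hn⟩ := hdiv v hb
    refine ⟨v - fun _ => n, ?_, ?_⟩
    · change Phi d B γ _ = 0
      rw [Phi_eq_zero, map_sub, Ah_ones, sub_zero, sum_sub_const, hn, hsum]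
      exact ⟨by ring, hb⟩
    · rw [map_sub, Ah_ones, sub_zero]
  · rintro ⟨v, hv, rfl⟩
    exact ((Phi_eq_zero d B γ v).1 hv).2

lemma part2 (d : ℕ) (B B' : AddSubgroup (L d)) (γ γ' : Fin (d + 1) → ℤ)
    (h : GoodBgamma d B γ) (h' : GoodBgamma d B' γ')
    (he : ∃ e : GB d B γ ≃+ GB d B' γ', ∀ i, e (xE d B γ i) = xE d B' γ' i) :
    B = B' ∧ γ = γ' := by
  obtain ⟨e, he⟩ := he
  have key : ∀ v, Phi d B γ v = 0 ↔ Phi d B' γ' v = 0 := by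
    intro v
    rw [← xE_sum, ← xE_sum, ZeroMemClass.coe_eq_zero, ZeroMemClass.coe_eq_zero,
      ← e.map_eq_zero_iff, map_sum]
    simp only [map_zsmul, he]
  have hk : (Phi d B γ).ker = (Phi d B' γ').ker := by
    ext v; exact key v
  have hBB : B = B' := by
    rw [mem_B_iff d B γ h, mem_B_iff d B' γ' h', hk]
  refine ⟨hBB, ?_⟩
  subst hBB
  obtain ⟨hB, hpos, hsum, hdiv⟩ := h
  obtain ⟨-, hpos', hsum', hdiv'⟩ := h'
  funext i
  have hs : ∀ δ : Fin (d + 1) → ℤ,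
      ∑ j, ((B.index : ℤ) • (Pi.single i 1 : V d)) j * δ j = B.index * δ i := by
    intro δ
    simp [Pi.single_apply]
  have h1 : Phi d B γ ((B.index : ℤ) • (Pi.single i 1 : V d) - fun _ => γ i) = 0 := by
    rw [Phi_eq_zero, sum_sub_const, map_sub, Ah_ones, sub_zero, hs, hsum, map_zsmul]
    refine ⟨by ring, ?_⟩
    rw [natCast_zsmul]
    exact B.nsmul_index_mem _
  rw [key, Phi_eq_zero, sum_sub_const, hs, hsum'] at h1
  have hm : (B.index : ℤ) ≠ 0 := by exact_mod_cast hB.index_ne_zero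
  apply mul_left_cancel₀ hm
  linarith [h1.1]

lemma PhiG_apply {G : Type*} [AddCommGroup G] (d : ℕ) (x : Fin (d + 1) → G) (v : V d) :
    PhiG d x v = ∑ i, v i • x i := rfl

lemma PhiG_const {G : Type*} [AddCommGroup G] (d : ℕ) (x : Fin (d + 1) → G) (n : ℤ) :
    PhiG d x (fun _ => n) = n • ∑ i, x i := by
  rw [PhiG_apply, Finset.smul_sum]

lemma PhiG_single {G : Type*} [AddCommGroup G] (d : ℕ) (x : Fin (d + 1) → G) (i) :
    PhiG d x (Pi.single i 1) = x i := by
  rw [PhiG_apply, Finset.sum_eq_single i]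
  · simp
  · intro j _ hj
    simp [hj]
  · simp

/-- No nontrivial nonnegative relation. -/
lemma norel {G : Type*} [AddCommGroup G] (d : ℕ) (x : Fin (d + 1) → G)
    (h1 : ∀ i, x i ≠ 0) (h3 : ∀ g : G, g ∈ cone x → -g ∈ cone x → g = 0)
    (c : Fin (d + 1) → ℕ) (hc : ∑ i, (c i : ℤ) • x i = 0) (i) : c i = 0 := by
  by_contra hi
  apply h1 i
  have hs := PhiG_single d x i
  apply h3
  · refine ⟨Pi.single i 1, ?_⟩
    rw [← hs, PhiG_apply]
    refine Finset.sum_congr rfl fun j _ => ?_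
    by_cases hj : j = i
    · subst hj; simp
    · simp [hj]
  · refine ⟨c - Pi.single i 1, ?_⟩
    have : ∀ j, ((c - Pi.single i 1 : Fin (d + 1) → ℕ) j : ℤ)
        = ((fun j => (c j : ℤ)) - (Pi.single i 1 : V d)) j := by
      intro j
      by_cases hj : j = i
      · subst hj
        have : 1 ≤ c j := Nat.one_le_iff_ne_zero.2 hi
        simp [this]
      · simp [hj]
    simp only [this]
    rw [← PhiG_apply, map_sub, hs, PhiG_apply, hc, zero_sub]

lemma signs {G : Type*} [AddCommGroup G] (d : ℕ) (x : Fin (d + 1) → G)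
    (h1 : ∀ i, x i ≠ 0) (h3 : ∀ g : G, g ∈ cone x → -g ∈ cone x → g = 0)
    (π : G →+ ℤ) (hπ : ∀ g : G, π g = 0 → IsOfFinAddOrder g) (c : Fin (d + 1) → ℕ)
    (hc : ∑ i, (c i : ℤ) * π (x i) = 0) (i) : c i = 0 := by
  have : IsOfFinAddOrder (∑ i, (c i : ℤ) • x i) := by
    apply hπ
    rw [map_sum, ← hc]
    exact Finset.sum_congr rfl fun i _ => by rw [map_zsmul, smul_eq_mul]
  rw [isOfFinAddOrder_iff_nsmul_eq_zero] at this
  obtain ⟨n, hn, hz⟩ := this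
  have := norel d x h1 h3 (fun i => n * c i) (by
    rw [← hz, Finset.smul_sum]
    refine Finset.sum_congr rfl fun i _ => ?_
    push_cast
    rw [mul_smul, natCast_zsmul]) i
  rcases Nat.mul_eq_zero.1 this with h | h
  · omega
  · exact h

lemma exists_pos {G : Type*} [AddCommGroup G] (d : ℕ) (x : Fin (d + 1) → G)
    (h1 : ∀ i, x i ≠ 0) (h3 : ∀ g : G, g ∈ cone x → -g ∈ cone x → g = 0)
    (π : G →+ ℤ) (hπ : ∀ g : G, π g = 0 → IsOfFinAddOrder g) :
    ∃ ρ : G →+ ℤ, (∀ g : G, ρ g = 0 → IsOfFinAddOrder g) ∧ ∀ i, 0 < ρ (x i) := by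
  have hne : ∀ i, π (x i) ≠ 0 := by
    intro i hi
    have := signs d x h1 h3 π hπ (Pi.single i 1) (by
      refine Finset.sum_eq_zero fun j _ => ?_
      by_cases hj : j = i
      · subst hj; simp [hi]
      · simp [hj]) i
    simp at this
  have hsame : ∀ i j, ¬ (0 < π (x i) ∧ π (x j) < 0) := by
    rintro i j ⟨hi, hj⟩
    have hij : i ≠ j := by rintro rfl; omega
    have := signs d x h1 h3 π hπ
      (fun k => if k = i then (-π (x j)).toNat else if k = j then (π (x i)).toNat else 0) (by
      rw [Finset.sum_eq_add i j hij]
      · simp [hij.symm, max_eq_left hi.le, max_eq_left (show 0 ≤ -π (x j) by omega)]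
        ring
      · intro k _ hk
        simp [hk.1, hk.2]
      · simp
      · simp) i
    simp at this
    omega
  rcases lt_or_gt_of_ne (hne 0) with h0 | h0
  · refine ⟨-π, fun g hg => hπ g (by simpa using hg), fun i => ?_⟩
    have := hsame i 0
    have := hne i
    simp only [AddMonoidHom.neg_apply]
    omega
  · refine ⟨π, hπ, fun i => ?_⟩
    have := hsame 0 i
    have := hne i
    omega

lemma part3 (d : ℕ) (G : Type*) [AddCommGroup G] (x : Fin (d + 1) → G)
    (h : GoodPair d G x) :
      ∃ (B : AddSubgroup (L d)) (γ : Fin (d + 1) → ℤ), GoodBgamma d B γ ∧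
        ∃ e : G ≃+ GB d B γ, ∀ i, e (x i) = xE d B γ i := by
  obtain ⟨-, ⟨π, -, hπ⟩, h1, h2, h3⟩ := h
  obtain ⟨ρ, hρ, hpos⟩ := exists_pos d x h1 h3 π fun g => (hπ g).1
  let B : AddSubgroup (L d) := (PhiG d x).ker.map (Ah d)
  set p : G := ∑ i, x i with hp
  have hs : 0 < ρ p := by
    rw [hp, map_sum]
    exact Finset.sum_pos (fun i _ => hpos i) ⟨0, Finset.mem_univ _⟩
  have hpinj : ∀ a b : ℤ, a • p = b • p → a = b := by
    intro a b hab
    have := congrArg ρ hab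
    rw [map_zsmul, map_zsmul, smul_eq_mul, smul_eq_mul] at this
    exact mul_right_cancel₀ hs.ne' this
  have hBp : ∀ v, Ah d v ∈ B ↔ ∃ n : ℤ, PhiG d x v = n • p := by
    intro v
    constructor
    · rintro ⟨k, hk, hkv⟩
      have hk0 : PhiG d x k = 0 := hk
      have hc := Ah_ker d (v - k) (by rw [map_sub, hkv, sub_self])
      refine ⟨(v - k) 0, ?_⟩
      rw [← PhiG_const, ← funext hc]
      change _ = PhiG d x (v - k)
      rw [map_sub, hk0, sub_zero]
    · rintro ⟨n, hn⟩
      refine ⟨v - fun _ => n, ?_, ?_⟩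
      · change PhiG d x _ = 0
        rw [map_sub, PhiG_const, hn, sub_self]
      · rw [map_sub, Ah_ones, sub_zero]
  have hfin : Finite (L d ⧸ B) := by
    have : Module.Finite ℤ (V d) := inferInstance
    have hsurj : Function.Surjective ((QuotientAddGroup.mk' B).comp (Ah d)) :=
      (QuotientAddGroup.mk'_surjective B).comp (Ah_surj d)
    have : Module.Finite ℤ (L d ⧸ B) :=
      Module.Finite.of_surjective ((QuotientAddGroup.mk' B).comp (Ah d)).toIntLinearMap hsurj
    apply Module.finite_of_fg_torsion
    intro q
    obtain ⟨v, rfl⟩ := hsurj q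
    have : IsOfFinAddOrder (ρ p • PhiG d x v - ρ (PhiG d x v) • p) := by
      apply hρ
      rw [map_sub, map_zsmul, map_zsmul, smul_eq_mul, smul_eq_mul]
      ring
    rw [isOfFinAddOrder_iff_nsmul_eq_zero] at this
    obtain ⟨n, hn, hz⟩ := this
    have hnz : (n : ℤ) * ρ p ≠ 0 := mul_ne_zero (by exact_mod_cast hn.ne') hs.ne'
    refine ⟨⟨(n : ℤ) * ρ p, mem_nonZeroDivisors_of_ne_zero hnz⟩, ?_⟩
    change ((n : ℤ) * ρ p) • ((QuotientAddGroup.mk' B).comp (Ah d)) v = 0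
    rw [← map_zsmul]
    change ((Ah d (((n : ℤ) * ρ p) • v) : L d) : L d ⧸ B) = 0
    rw [QuotientAddGroup.eq_zero_iff, hBp]
    refine ⟨n * ρ (PhiG d x v), ?_⟩
    rw [map_zsmul, mul_smul, mul_smul, ← sub_eq_zero, ← smul_sub, natCast_zsmul, hz]
  have hBf : B.FiniteIndex := AddSubgroup.finiteIndex_of_finite_quotient
  have hm0 : 0 < (B.index : ℤ) := by exact_mod_cast Nat.pos_of_ne_zero hBf.index_ne_zero
  have hγ : ∀ i, ∃ n : ℤ, (B.index : ℤ) • x i = n • p := by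
    intro i
    obtain ⟨n, hn⟩ := (hBp ((B.index : ℤ) • Pi.single i 1)).1 (by
      rw [map_zsmul, natCast_zsmul]
      exact B.nsmul_index_mem _)
    rw [map_zsmul, PhiG_single] at hn
    exact ⟨n, hn⟩
  choose γ hγ using hγ
  have htau : ∀ v : V d, (B.index : ℤ) • PhiG d x v = (∑ i, v i * γ i) • p := by
    intro v
    rw [PhiG_apply, Finset.smul_sum, Finset.sum_smul]
    refine Finset.sum_congr rfl fun i _ => ?_
    rw [smul_comm, hγ, mul_smul]
  have hn : ∀ (v : V d) (n : ℤ), PhiG d x v = n • p → ∑ i, v i * γ i = B.index * n := by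
    intro v n hv
    apply hpinj
    rw [← htau, hv, mul_smul]
  have hker : ∀ v, PhiG d x v = 0 ↔ Phi d B γ v = 0 := by
    intro v
    rw [Phi_eq_zero]
    constructor
    · intro hv
      have hv' : PhiG d x v = (0 : ℤ) • p := by rw [hv, zero_smul]
      exact ⟨by rw [hn v 0 hv', mul_zero], (hBp v).2 ⟨0, hv'⟩⟩
    · rintro ⟨hv, hvB⟩
      obtain ⟨n, hv2⟩ := (hBp v).1 hvB
      rw [hn v n hv2] at hv
      have : n = 0 := by
        rcases mul_eq_zero.1 hv with h | h
        · omega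
        · exact h
      rw [hv2, this, zero_smul]
  refine ⟨B, γ, ⟨hBf, ?_, ?_, ?_⟩, ?_⟩
  · intro i
    have := congrArg ρ (hγ i)
    rw [map_zsmul, map_zsmul, smul_eq_mul, smul_eq_mul] at this
    have h4 : 0 < γ i * ρ p := by rw [← this]; exact mul_pos hm0 (hpos i)
    exact pos_of_mul_pos_left h4 hs.le
  · have := hn (fun _ => 1) 1 (PhiG_const d x 1)
    simpa using this
  · intro v hv
    obtain ⟨n, hv2⟩ := (hBp v).1 hv
    exact ⟨n, hn v n hv2⟩
  · have hsurj : Function.Surjective (PhiG d x) := by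
      intro g
      obtain ⟨c, hc⟩ := h2 g
      exact ⟨c, hc.symm⟩
    have hkk : (PhiG d x).ker = (Phi d B γ).ker := by
      ext v; exact hker v
    let e1 := QuotientAddGroup.quotientKerEquivOfSurjective (PhiG d x) hsurj
    let e2 := QuotientAddGroup.quotientAddEquivOfEq hkk
    let e3 := QuotientAddGroup.quotientKerEquivRange (Phi d B γ)
    refine ⟨e1.symm.trans (e2.trans e3), fun i => ?_⟩
    have : e1.symm (x i) = QuotientAddGroup.mk (Pi.single i 1 : V d) := by
      rw [AddEquiv.symm_apply_eq]
      exact (PhiG_single d x i).symm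
    rw [AddEquiv.trans_apply, this]
    rfl

theorem Bgamma_bijection_rank_one_pairs (d : ℕ) (hd : 1 ≤ d) :
    (∀ (B : AddSubgroup (L d)) (γ : Fin (d + 1) → ℤ), GoodBgamma d B γ →
      GoodPair d (GB d B γ) (xE d B γ)) ∧
    (∀ (B B' : AddSubgroup (L d)) (γ γ' : Fin (d + 1) → ℤ),
      GoodBgamma d B γ → GoodBgamma d B' γ' →
      (∃ e : GB d B γ ≃+ GB d B' γ', ∀ i, e (xE d B γ i) = xE d B' γ' i) →
      B = B' ∧ γ = γ') ∧
    (∀ (G : Type) [inst : AddCommGroup G], ∀ (x : Fin (d + 1) → G), GoodPair d G x →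
      ∃ (B : AddSubgroup (L d)) (γ : Fin (d + 1) → ℤ), GoodBgamma d B γ ∧
        ∃ e : G ≃+ GB d B γ, ∀ i, e (x i) = xE d B γ i) := by
  exact ⟨part1 d, part2 d, fun G _ x h => part3 d G x h⟩

end Paper
end
end
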